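/- Let (X,d) be a separable metric space directionally (ξ,η,ζ)-limited at X and endowed with an asymptotically (α,γ)-bounded Borel measure ν (α ∈ (0,1], γ ≥ 1). Let μ be a positive Borel measure on X (not necessarily finite on bounded sets) and let q be a premeasure on closed balls satisfying C^{-1} μ(B_{αr}(x)) ≤ q(B_r(x)) ≤ C μ(B_r(x)) for some C ≥ 1, r₀ > 0, all x ∈ X and all 0 < r < r₀. Then the packing construction ĥμ^q is countably sub-additive: ĥμ^q(∪_n A_n) ≤ Σ_n ĥμ^q(A_n) for every countable family (A_n)_n of subsets of X. -/

import Mathlib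

open MeasureTheory Metric Set Filter Topology ENNReal Bornology

/-- `(X,d)` is directionally `(ξ,η,ζ)`-limited at `A`: for every `a ∈ A` and every
`B ⊆ A ∩ (U_ξ(a) \ {a})` such that for all distinct `b, c ∈ B` with `d(a,b) ≥ d(a,c)`,
every `x` with `d(a,x) = d(a,c)` and `d(a,x) + d(x,b) = d(a,b)` satisfies
`d(x,c)/d(a,c) ≥ η`, the set `B` has cardinality at most `ζ`. -/
def DirLimited {X : Type*} [MetricSpace X] (A : Set X) (ξ η : ℝ) (ζ : ℕ) : Prop :=
  ∀ a ∈ A, ∀ B : Set X, B ⊆ A ∩ (Metric.ball a ξ \ {a}) →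
    (∀ b ∈ B, ∀ c ∈ B, b ≠ c → dist a c ≤ dist a b →
      ∀ x : X, dist a x = dist a c → dist a x + dist x b = dist a b →
        η ≤ dist x c / dist a c) →
    B.Finite ∧ B.ncard ≤ ζ
/-- `ν` is asymptotically `(α,γ)`-bounded: finite on bounded sets, strictly positive on
balls of positive radius, and `limsup_{r→0⁺} ν(B_r(x))/ν(B_{αr}(x)) ≤ γ` for all `x`. -/
def AsympBounded {X : Type*} [MetricSpace X] [MeasurableSpace X]
    (ν : MeasureTheory.Measure X) (α γ : ℝ) : Prop :=
  (∀ s : Set X, Bornology.IsBounded s → ν s < ⊤) ∧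
  (∀ (x : X) (r : ℝ), 0 < r → 0 < ν (Metric.closedBall x r)) ∧
  (∀ x : X, Filter.limsup
      (fun r : ℝ => ν (Metric.closedBall x r) / ν (Metric.closedBall x (α * r)))
      (nhdsWithin 0 (Set.Ioi 0)) ≤ ENNReal.ofReal γ)
/-- A packing of the open set `U` of order `δ`: a countable family of pairwise disjoint
closed balls, each of positive radius at most `δ` and contained in `U`, encoded as a
countable set of (center, radius) pairs. -/
def IsPackingOf {X : Type*} [MetricSpace X] (U : Set X) (δ : ℝ) (P : Set (X × ℝ)) : Prop :=
  P.Countable ∧ (∀ p ∈ P, 0 < p.2 ∧ p.2 ≤ δ ∧ Metric.closedBall p.1 p.2 ⊆ U) ∧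
  P.Pairwise fun p p' => Disjoint (Metric.closedBall p.1 p.2) (Metric.closedBall p'.1 p'.2)

/-- `ĥμ^q_δ(U)`: supremum of `∑_{B ∈ ℱ} q(B)` over packings `ℱ` of `U` of order `δ`. -/
noncomputable def packPre {X : Type*} [MetricSpace X] (q : X → ℝ → ℝ≥0∞) (δ : ℝ)
    (U : Set X) : ℝ≥0∞ :=
  ⨆ (P : Set (X × ℝ)) (_ : IsPackingOf U δ P), ∑' p : P, q p.1.1 p.1.2

/-- `ĥμ^q(U) = inf_{δ>0} ĥμ^q_δ(U)` for `U` open. -/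
noncomputable def packOpen {X : Type*} [MetricSpace X] (q : X → ℝ → ℝ≥0∞)
    (U : Set X) : ℝ≥0∞ :=
  ⨅ (δ : ℝ) (_ : 0 < δ), packPre q δ U

/-- The packing construction extended to arbitrary sets:
`ĥμ^q(A) = inf { ĥμ^q(U) : A ⊆ U, U open }`. -/
noncomputable def packM {X : Type*} [MetricSpace X] (q : X → ℝ → ℝ≥0∞)
    (A : Set X) : ℝ≥0∞ :=
  ⨅ (U : Set X) (_ : IsOpen U) (_ : A ⊆ U), packOpen q U

/-- The arithmetic behind the bound on satellite configurations: two balls of comparable size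
touching a smaller ball of radius `ρ`, whose centres have almost the same direction as seen from
the centre of the latter, cannot be far from each other. -/
lemma satellite_arith {ρ db dc rb rc D : ℝ}
    (hdb : db ≤ rb + ρ) (hdc : rc ≤ dc) (hdc' : dc ≤ rc + ρ)
    (hb : ρ ≤ 11 / 10 * rb) (hc : ρ ≤ 11 / 10 * rc) (hρ : 0 < ρ)
    (hD : rb ≤ D ∧ rc ≤ 11 / 10 * rb ∨ rc ≤ D ∧ rb ≤ 11 / 10 * rc)
    (hlt : D < db - dc + dc / 3)
    (hcls : (2 * ρ ≤ rb ∧ 2 * ρ ≤ rc) ∨ db - dc < ρ / 4) : False := by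
  rcases hD with ⟨h1, h2⟩ | ⟨h1, h2⟩ <;> rcases hcls with ⟨h3, h4⟩ | h3 <;> linarith

/-- Subsets of small diameter of a directionally limited space satisfy the Besicovitch covering
property. -/
lemma DirLimited.hasBesicovitchCovering {X : Type*} [MetricSpace X] {ξ η : ℝ} {ζ : ℕ}
    (hη' : η ≤ 1 / 3) (hdir : DirLimited (Set.univ : Set X) ξ η ζ) {S : Set X}
    (hS : ∀ x ∈ S, ∀ y ∈ S, dist x y < ξ) : HasBesicovitchCovering S := by
  refine ⟨13 * ζ + 1, 11 / 10, by norm_num, ⟨fun a => ?_⟩⟩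
  set N := 13 * ζ + 1 with hN
  set z : S := a.c (Fin.last N) with hz
  set ρ : ℝ := a.r (Fin.last N) with hρ
  have ρpos : 0 < ρ := a.rpos _
  let c : Fin N → S := fun i => a.c i.castSucc
  let r : Fin N → ℝ := fun i => a.r i.castSucc
  have rpos : ∀ i, 0 < r i := fun i => a.rpos _
  have hr1 : ∀ i, r i ≤ dist (z : X) (c i) := fun i => by
    rw [dist_comm]; exact (a.hlast _ (Fin.castSucc_lt_last i)).1
  have hr2 : ∀ i, ρ ≤ 11 / 10 * r i := fun i => (a.hlast _ (Fin.castSucc_lt_last i)).2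
  have hr3 : ∀ i, dist (z : X) (c i) ≤ r i + ρ := fun i => by
    rw [dist_comm]; exact a.inter _ (Fin.castSucc_lt_last i)
  have hr4 : ∀ i j, i ≠ j → r i ≤ dist (c i : X) (c j) ∧ r j ≤ 11 / 10 * r i ∨
      r j ≤ dist (c i : X) (c j) ∧ r i ≤ 11 / 10 * r j := fun i j hij => by
    have := a.h (i := i.castSucc) (j := j.castSucc)
      (fun h => hij (Fin.castSucc_injective _ h))
    beta_reduce at this
    rw [dist_comm (a.c j.castSucc)] at this
    exact this
  have cinj : Function.Injective fun i => (c i : X) := fun i j h => by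
    by_contra hij
    have h0 : dist (c i : X) (c j) = 0 := by rw [dist_eq_zero]; exact h
    have := hr4 i j hij
    have h1 := rpos i
    have h2 := rpos j
    rcases this with h | h <;> linarith [h.1]
  let cls : Fin N → ℕ := fun i =>
    if 2 * ρ ≤ r i then 12 else ⌊4 * dist (z : X) (c i) / ρ⌋₊
  have hcls : ∀ i ∈ (Finset.univ : Finset (Fin N)), cls i ∈ Finset.range 13 := fun i _ => by
    simp only [cls, Finset.mem_range]
    split_ifs with h
    · norm_num
    · rw [Nat.floor_lt (by positivity), div_lt_iff₀ ρpos]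
      push_cast
      linarith [hr3 i]
  obtain ⟨k, -, hk⟩ := Finset.exists_lt_card_fiber_of_mul_lt_card_of_maps_to hcls (n := ζ)
    (by simp [hN])
  have key := hdir z (mem_univ _)
    ((fun i => (c i : X)) '' ((Finset.univ.filter fun i => cls i = k : Finset (Fin N)) : Set (Fin N)))
    ?_ ?_
  · rw [Set.ncard_image_of_injective _ cinj, Set.ncard_coe_finset] at key
    omega
  · rintro _ ⟨i, -, rfl⟩
    refine ⟨mem_univ _, ?_, ?_⟩
    · exact hS _ (c i).2 _ z.2
    · intro h
      have h0 : dist (z : X) (c i) = 0 := by rw [dist_eq_zero]; exact h.symm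
      linarith [hr1 i, rpos i]
  · rintro _ ⟨i, hi, rfl⟩ _ ⟨j, hj, rfl⟩ hne hle x hx1 hx2
    have hij : i ≠ j := fun h => hne (by rw [h])
    have hpos : 0 < dist (z : X) (c j) := (rpos j).trans_le (hr1 j)
    simp only at hle hx1 hx2 ⊢
    rw [le_div_iff₀ hpos]
    by_contra! hlt
    have hη3 : η * dist (z : X) (c j) ≤ dist (z : X) (c j) / 3 := by nlinarith
    have htri := dist_triangle (c i : X) x (c j)
    rw [dist_comm (c i : X) x] at htri
    refine satellite_arith (hr3 i) (hr1 j) (hr3 j) (hr2 i) (hr2 j) ρpos (hr4 i j hij) (by linarith) ?_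
    have hi' : cls i = k := by simpa using hi
    have hj' : cls j = k := by simpa using hj
    have hlt12 : ∀ l, ¬ 2 * ρ ≤ r l → ⌊4 * dist (z : X) (c l) / ρ⌋₊ < 12 := fun l hl => by
      rw [Nat.floor_lt (by positivity), div_lt_iff₀ ρpos]
      push_cast
      linarith [hr3 l]
    simp only [cls] at hi' hj'
    split_ifs at hi' hj' with h1 h2 h2
    · exact Or.inl ⟨h1, h2⟩
    · have := hlt12 j h2; omega
    · have := hlt12 i h1; omega
    · right
      have e1 : 4 * dist (z : X) (c i) / ρ < ⌊4 * dist (z : X) (c i) / ρ⌋₊ + 1 :=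
        Nat.lt_floor_add_one _
      have e2 : (⌊4 * dist (z : X) (c j) / ρ⌋₊ : ℝ) ≤ 4 * dist (z : X) (c j) / ρ :=
        Nat.floor_le (by positivity)
      rw [hi'] at e1
      rw [hj'] at e2
      rw [div_lt_iff₀ ρpos] at e1
      rw [le_div_iff₀ ρpos] at e2
      linarith

/-- A separable metric space is, up to a null set, a countable disjoint union of open sets of
small diameter. -/
lemma exists_disjoint_open_small {X : Type*} [MetricSpace X] [MeasurableSpace X] [BorelSpace X]
    [TopologicalSpace.SeparableSpace X] (m : Measure X) [SFinite m] {ξ : ℝ} (hξ : 0 < ξ) :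
    ∃ W : ℕ → Set X, (∀ i, IsOpen (W i)) ∧ Pairwise (fun i j => Disjoint (W i) (W j)) ∧
      (∀ i, ∀ x ∈ W i, ∀ y ∈ W i, dist x y < ξ) ∧ m (⋃ i, W i)ᶜ = 0 := by
  cases isEmpty_or_nonempty X
  · exact ⟨fun _ => ∅, fun _ => isOpen_empty, fun _ _ _ => by simp, by simp,
      by simp [Set.eq_empty_of_isEmpty]⟩
  let z := TopologicalSpace.denseSeq X
  have hz : DenseRange z := TopologicalSpace.denseRange_denseSeq X
  choose r hr hr0 using fun i => exists_null_frontier_thickening m {z i}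
    (show ξ / 4 < ξ / 2 by linarith)
  simp only [thickening_singleton] at hr0
  let W : ℕ → Set X := fun i => ball (z i) (r i) \ ⋃ j ∈ Finset.range i, closure (ball (z j) (r j))
  have hWb : ∀ i, W i ⊆ ball (z i) (r i) := fun i => sdiff_subset
  have hdis : ∀ i j, i < j → Disjoint (W i) (W j) := fun i j hij => by
    rw [Set.disjoint_left]
    rintro x hxi ⟨-, hxj⟩
    exact hxj (mem_biUnion (Finset.mem_range.2 hij) (subset_closure (hWb i hxi)))
  refine ⟨W, fun i => ?_, fun i j hij => ?_, fun i x hx y hy => ?_, ?_⟩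
  · exact isOpen_ball.sdiff ((Finset.range i).finite_toSet.isClosed_biUnion
      fun _ _ => isClosed_closure)
  · rcases hij.lt_or_gt with h | h
    · exact hdis i j h
    · exact (hdis j i h).symm
  · have h1 := mem_ball.1 (hWb i hx)
    have h2 := mem_ball.1 (hWb i hy)
    have := dist_triangle_right x y (z i)
    linarith [(hr i).2]
  · refine measure_mono_null ?_ (measure_iUnion_null hr0)
    intro x hx
    have hex : ∃ i, x ∈ ball (z i) (r i) := by
      obtain ⟨i, hi⟩ := hz.exists_dist_lt x (show 0 < ξ / 4 by linarith)
      exact ⟨i, mem_ball.2 (hi.trans (hr i).1)⟩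
    classical
    by_contra hfr
    refine hx (mem_iUnion.2 ⟨Nat.find hex, Nat.find_spec hex, ?_⟩)
    simp only [mem_iUnion, not_exists, Finset.mem_range]
    intro j hj hxj
    refine hfr (mem_iUnion.2 ⟨j, ?_⟩)
    rw [isOpen_ball.frontier_eq]
    exact ⟨hxj, Nat.find_min hex hj⟩

/-- A measurable Vitali covering theorem for directionally limited spaces. -/
lemma DirLimited.exists_disjoint_closedBall_covering_ae {X : Type*} [MetricSpace X]
    [MeasurableSpace X] [BorelSpace X] [TopologicalSpace.SeparableSpace X] {ξ η : ℝ} {ζ : ℕ}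
    (hξ : 0 < ξ) (hη' : η ≤ 1 / 3) (hdir : DirLimited (Set.univ : Set X) ξ η ζ)
    (m : Measure X) [SFinite m] (f : X → Set ℝ) (s : Set X)
    (hf : ∀ x ∈ s, ∀ δ > 0, (f x ∩ Ioo 0 δ).Nonempty) (R : X → ℝ) (hR : ∀ x ∈ s, 0 < R x) :
    ∃ P : Set (X × ℝ), P.Countable ∧
      (∀ p ∈ P, p.1 ∈ s ∧ p.2 ∈ f p.1 ∧ 0 < p.2 ∧ p.2 < R p.1) ∧
      (P.Pairwise fun p p' => Disjoint (closedBall p.1 p.2) (closedBall p'.1 p'.2)) ∧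
      m (s \ ⋃ p ∈ P, closedBall p.1 p.2) = 0 := by
  have : SecondCountableTopology X := UniformSpace.secondCountable_of_separable X
  obtain ⟨W, hWo, hWd, hWs, hW0⟩ := exists_disjoint_open_small m.toFinite hξ
  have hloc : ∀ i, ∃ P : Set (X × ℝ), P.Countable ∧
      (∀ p ∈ P, p.1 ∈ s ∧ p.2 ∈ f p.1 ∧ 0 < p.2 ∧ p.2 < R p.1 ∧ closedBall p.1 p.2 ⊆ W i) ∧
      (P.Pairwise fun p p' => Disjoint (closedBall p.1 p.2) (closedBall p'.1 p'.2)) ∧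
      m.toFinite ((s ∩ W i) \ ⋃ p ∈ P, closedBall p.1 p.2) = 0 := by
    intro i
    have := hdir.hasBesicovitchCovering hη' (hWs i)
    have hrad : ∀ x : W i, ∃ ρ > 0, closedBall (x : X) ρ ⊆ W i := fun x =>
      nhds_basis_closedBall.mem_iff.1 ((hWo i).mem_nhds x.2)
    choose ρ hρ hρW using hrad
    obtain ⟨t, r, htc, hts, htr, ht0, htd⟩ := Besicovitch.exists_disjoint_closedBall_covering_ae
      (m.toFinite.comap ((↑) : W i → X)) (fun x => f x) {x : W i | (x : X) ∈ s} (fun x hx => hf x hx)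
      (fun x => min (R x) (ρ x)) (fun x hx => lt_min (hR x hx) (hρ x))
    have hsub : ∀ x ∈ t, closedBall (x : X) (r x) ⊆ W i := fun x hx =>
      (closedBall_subset_closedBall ((htr x hx).2.2.le.trans (min_le_right _ _))).trans (hρW x)
    refine ⟨(fun x : W i => ((x : X), r x)) '' t, htc.image _, ?_, ?_, ?_⟩
    · rintro _ ⟨x, hx, rfl⟩
      exact ⟨hts hx, (htr x hx).1, (htr x hx).2.1, (htr x hx).2.2.trans_le (min_le_left _ _),
        hsub x hx⟩
    · rintro _ ⟨x, hx, rfl⟩ _ ⟨y, hy, rfl⟩ hxy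
      have hd := htd hx hy (fun h => hxy (by rw [h]))
      rw [Set.disjoint_left]
      intro w hwx hwy
      exact Set.disjoint_left.1 hd
        (show (⟨w, hsub x hx hwx⟩ : W i) ∈ closedBall x (r x) from hwx) hwy
    · rw [comap_subtype_coe_apply (hWo i).measurableSet] at ht0
      refine measure_mono_null ?_ ht0
      rintro x ⟨⟨hxs, hxW⟩, hxP⟩
      refine ⟨⟨x, hxW⟩, ⟨hxs, fun hx => hxP ?_⟩, rfl⟩
      obtain ⟨y, hy, hxy⟩ := mem_iUnion₂.1 hx
      exact mem_biUnion (mem_image_of_mem _ hy) hxy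
  choose P hPc hP hPd hP0 using hloc
  refine ⟨⋃ i, P i, countable_iUnion hPc, fun p hp => ?_, ?_, ?_⟩
  · obtain ⟨i, hi⟩ := mem_iUnion.1 hp
    obtain ⟨h1, h2, h3, h4, -⟩ := hP i p hi
    exact ⟨h1, h2, h3, h4⟩
  · intro p hp p' hp' hne
    obtain ⟨i, hi⟩ := mem_iUnion.1 hp
    obtain ⟨j, hj⟩ := mem_iUnion.1 hp'
    by_cases hij : i = j
    · subst hij
      exact hPd i hi hj hne
    · exact (hWd hij).mono (hP i p hi).2.2.2.2 (hP j p' hj).2.2.2.2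
  · refine absolutelyContinuous_toFinite m (measure_mono_null ?_
      (measure_union_null hW0 (measure_iUnion_null hP0)))
    rintro x ⟨hxs, hx⟩
    by_cases hxW : x ∈ ⋃ i, W i
    · right
      obtain ⟨i, hi⟩ := mem_iUnion.1 hxW
      refine mem_iUnion.2 ⟨i, ⟨hxs, hi⟩, fun hxP => hx ?_⟩
      exact biUnion_mono (subset_iUnion P i) (fun _ _ => subset_rfl) hxP
    · exact Or.inl hxW

lemma exists_le_mul_of_geometric {u v : ℕ → ℝ} {a b κ : ℝ} (ha : 0 < a) (hab : a < b)
    (hu : ∀ k, b * u (k + 1) ≤ u k) (hv : ∀ k, v k ≤ a * v (k + 1)) (hv0 : 0 < v 0)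
    (hκ : 0 < κ) : ∀ᶠ k in atTop, u k ≤ κ * v k := by
  have hb : 0 < b := ha.trans hab
  have hu' : ∀ k, b ^ k * u k ≤ u 0 := fun k => by
    induction k with
    | zero => simp
    | succ k ih =>
      calc b ^ (k + 1) * u (k + 1) = b ^ k * (b * u (k + 1)) := by ring
        _ ≤ b ^ k * u k := by gcongr; exact hu k
        _ ≤ u 0 := ih
  have hv' : ∀ k, v 0 ≤ a ^ k * v k := fun k => by
    induction k with
    | zero => simp
    | succ k ih =>
      calc v 0 ≤ a ^ k * v k := ih
        _ ≤ a ^ k * (a * v (k + 1)) := by gcongr; exact hv k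
        _ = a ^ (k + 1) * v (k + 1) := by ring
  have hlim : Tendsto (fun k : ℕ => u 0 * (a / b) ^ k) atTop (𝓝 0) := by
    simpa using (tendsto_pow_atTop_nhds_zero_of_lt_one (by positivity)
      ((div_lt_one hb).2 hab)).const_mul (u 0)
  filter_upwards [hlim.eventually_le_const (show 0 < κ * v 0 by positivity)] with k hk
  have hak : 0 < a ^ k := by positivity
  have hbk : 0 < b ^ k := by positivity
  rw [div_pow, mul_div_assoc', div_le_iff₀ hbk] at hk
  have h1 := mul_le_mul_of_nonneg_left (hu' k) hak.le
  have h2 := mul_le_mul_of_nonneg_left (hv' k) (mul_pos hκ hbk).le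
  have h3 : (a ^ k * b ^ k) * u k ≤ (a ^ k * b ^ k) * (κ * v k) := by nlinarith
  exact le_of_mul_le_mul_left h3 (by positivity)

/-- If `ν` is asymptotically `(α,γ)`-bounded, then at a point where the measure `μ` of small balls
decays at a rate faster than `γ`, the ratio `μ(B_r(x))/ν(B_r(x))` is arbitrarily small along a
sequence of radii tending to zero. -/
lemma AsympBounded.exists_measure_le {X : Type*} [MetricSpace X] [MeasurableSpace X]
    {ν μ : Measure X} {α γ : ℝ} (hν : AsympBounded ν α γ) (hα : 0 < α) (hα1 : α ≤ 1)
    (hγ : 1 ≤ γ) {x : X} {ε : ℝ} (hε : 0 < ε)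
    (hfin : ∀ r, 0 < r → r < ε → μ (closedBall x r) ≠ ⊤)
    (hμ : ∀ r, 0 < r → r < ε →
      ENNReal.ofReal (γ + 1) * μ (closedBall x (α * r)) < μ (closedBall x r))
    {κ : ℝ} (hκ : 0 < κ) {δ : ℝ} (hδ : 0 < δ) :
    ∃ r, 0 < r ∧ r < δ ∧ μ (closedBall x r) ≤ ENNReal.ofReal κ * ν (closedBall x r) := by
  obtain ⟨hνb, hνp, hνl⟩ := hν
  have hνfin : ∀ r, ν (closedBall x r) ≠ ⊤ := fun r => (hνb _ isBounded_closedBall).ne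
  rcases hα1.lt_or_eq with hα1 | rfl
  swap
  · exfalso
    have h := hμ (ε / 2) (by linarith) (by linarith)
    rw [one_mul] at h
    refine absurd h (not_lt.2 (le_mul_of_one_le_left zero_le ?_))
    exact ENNReal.one_le_ofReal.2 (by linarith)
  have hev := eventually_lt_of_limsup_lt ((hνl x).trans_lt
    ((ENNReal.ofReal_lt_ofReal_iff (by linarith : (0 : ℝ) < γ + 1 / 2)).2
      (by linarith : γ < γ + 1 / 2)))
  obtain ⟨ε', hε', hlt⟩ := mem_nhdsGT_iff_exists_Ioo_subset.1 hev
  have hε'0 : 0 < ε' := hε'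
  set ρ := min ε ε' / 2 with hρ
  have hρ0 : 0 < ρ := by positivity
  have hρε : ρ < ε := by have := min_le_left ε ε'; linarith
  have hρε' : ρ < ε' := by have := min_le_right ε ε'; linarith
  have hk0 : ∀ k : ℕ, 0 < α ^ k * ρ := fun k => by positivity
  have hkρ : ∀ k : ℕ, α ^ k * ρ ≤ ρ := fun k =>
    mul_le_of_le_one_left hρ0.le (pow_le_one₀ hα.le hα1.le)
  have hk1 : ∀ k : ℕ, α * (α ^ k * ρ) = α ^ (k + 1) * ρ := fun k => by ring
  have hfink : ∀ k : ℕ, μ (closedBall x (α ^ k * ρ)) ≠ ⊤ := fun k =>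
    hfin _ (hk0 k) ((hkρ k).trans_lt hρε)
  have hmain := exists_le_mul_of_geometric (u := fun k => (μ (closedBall x (α ^ k * ρ))).toReal)
    (v := fun k => (ν (closedBall x (α ^ k * ρ))).toReal) (a := γ + 1 / 2) (b := γ + 1)
    (by linarith) (by linarith) (fun k => ?_) (fun k => ?_) ?_ hκ
  · have hsm : Tendsto (fun k : ℕ => α ^ k * ρ) atTop (𝓝 0) := by
      simpa using (tendsto_pow_atTop_nhds_zero_of_lt_one hα.le hα1).mul_const ρ
    obtain ⟨k, hk, hkδ⟩ := (hmain.and (hsm.eventually_lt_const hδ)).exists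
    refine ⟨α ^ k * ρ, hk0 k, hkδ, ?_⟩
    rw [← ENNReal.ofReal_toReal (hfink k), ← ENNReal.ofReal_toReal (hνfin (α ^ k * ρ)),
      ← ENNReal.ofReal_mul hκ.le]
    exact ENNReal.ofReal_le_ofReal hk
  · have h := (hμ _ (hk0 k) ((hkρ k).trans_lt hρε)).le
    rw [hk1] at h
    have h' := ENNReal.toReal_mono (hfink k) h
    rwa [ENNReal.toReal_mul, ENNReal.toReal_ofReal (by linarith)] at h'
  · have h := (mem_ofPred.1 (hlt ⟨hk0 k, (hkρ k).trans_lt hρε'⟩)).le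
    beta_reduce at h
    rw [hk1] at h
    rw [ENNReal.div_le_iff (hνp _ _ (hk0 _)).ne' (hνfin _)] at h
    have h' := ENNReal.toReal_mono (ENNReal.mul_ne_top ENNReal.ofReal_ne_top (hνfin _)) h
    rwa [ENNReal.toReal_mul, ENNReal.toReal_ofReal (by linarith)] at h'
  · exact ENNReal.toReal_pos (hνp _ _ (hk0 0)).ne' (hνfin _)

lemma IsPackingOf.tsum_le_packPre {X : Type*} [MetricSpace X] {q : X → ℝ → ℝ≥0∞} {U : Set X}
    {δ : ℝ} {P : Set (X × ℝ)} (hP : IsPackingOf U δ P) :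
    ∑' p : P, q p.1.1 p.1.2 ≤ packPre q δ U :=
  le_iSup₂_of_le P hP le_rfl

lemma le_packPre {X : Type*} [MetricSpace X] (q : X → ℝ → ℝ≥0∞) {U : Set X} {δ : ℝ} {x : X}
    {r : ℝ} (hr : 0 < r) (hrδ : r ≤ δ) (hU : closedBall x r ⊆ U) : q x r ≤ packPre q δ U := by
  have hP : IsPackingOf U δ {(x, r)} :=
    ⟨countable_singleton _, by rintro _ rfl; exact ⟨hr, hrδ, hU⟩, Set.pairwise_singleton _ _⟩
  simpa [tsum_singleton (x, r) fun p : X × ℝ => q p.1 p.2] using hP.tsum_le_packPre (q := q)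

lemma measure_le_tsum_closedBall {X : Type*} [MetricSpace X] [MeasurableSpace X]
    (m : Measure X) {P : Set (X × ℝ)} (hP : P.Countable) {s : Set X}
    (h : m (s \ ⋃ p ∈ P, closedBall p.1 p.2) = 0) :
    m s ≤ ∑' p : P, m (closedBall p.1.1 p.1.2) :=
  calc m s ≤ m ((s \ ⋃ p ∈ P, closedBall p.1 p.2) ∪ ⋃ p ∈ P, closedBall p.1 p.2) :=
        measure_mono fun x hx => by
          by_cases h : x ∈ ⋃ p ∈ P, closedBall p.1 p.2
          · exact Or.inr h
          · exact Or.inl ⟨hx, h⟩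
    _ ≤ 0 + m (⋃ p ∈ P, closedBall p.1 p.2) := h ▸ measure_union_le _ _
    _ ≤ ∑' p : P, m (closedBall p.1.1 p.1.2) := by
        rw [zero_add]
        exact measure_biUnion_le m hP fun p : X × ℝ => closedBall p.1 p.2

lemma tsum_measure_closedBall_le {X : Type*} [MetricSpace X] [MeasurableSpace X] [BorelSpace X]
    (m : Measure X) {P : Set (X × ℝ)} (hP : P.Countable)
    (hd : P.Pairwise fun p p' => Disjoint (closedBall p.1 p.2) (closedBall p'.1 p'.2))
    {s : Set X} (hs : ∀ p ∈ P, closedBall p.1 p.2 ⊆ s) :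
    ∑' p : P, m (closedBall p.1.1 p.1.2) ≤ m s := by
  rw [← measure_biUnion (f := fun p : X × ℝ => closedBall p.1 p.2) hP hd
    fun p _ => isClosed_closedBall.measurableSet]
  exact measure_mono (iUnion₂_subset hs)

/-- A measure which is finite on small balls centred in a set has σ-finite restriction to it. -/
lemma sFinite_restrict_of_finite_closedBall {X : Type*} [MetricSpace X] [MeasurableSpace X]
    [BorelSpace X] [TopologicalSpace.SeparableSpace X] {μ : Measure X} {V : Set X}
    (hV : MeasurableSet V) (h : ∀ x ∈ V, ∃ r > 0, μ (closedBall x r) ≠ ⊤) :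
    SFinite (μ.restrict V) := by
  have : SecondCountableTopology X := UniformSpace.secondCountable_of_separable X
  have : IsLocallyFiniteMeasure (μ.comap ((↑) : V → X)) := ⟨fun x => by
    obtain ⟨r, hr, hfin⟩ := h x x.2
    refine ⟨closedBall x r, closedBall_mem_nhds x hr, ?_⟩
    rw [comap_subtype_coe_apply hV]
    refine (measure_mono ?_).trans_lt hfin.lt_top
    rintro _ ⟨y, hy, rfl⟩
    exact hy⟩
  rw [← map_comap_subtype_coe hV]
  infer_instance

/-- In a directionally limited space with an asymptotically `(α,γ)`-bounded measure, a locally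
finite measure charges no set of points where its ball-doubling constant exceeds `γ + 1`. -/
lemma measure_setOf_fast_decay {X : Type*} [MetricSpace X] [MeasurableSpace X] [BorelSpace X]
    [TopologicalSpace.SeparableSpace X] {ξ η : ℝ} {ζ : ℕ} (hξ : 0 < ξ) (hη' : η ≤ 1 / 3)
    (hdir : DirLimited (Set.univ : Set X) ξ η ζ) {ν μ : Measure X} {α γ : ℝ} (hα : 0 < α)
    (hα1 : α ≤ 1) (hγ : 1 ≤ γ) (hν : AsympBounded ν α γ) {V : Set X}
    [SFinite (μ.restrict V)] {s : Set X} (hsV : s ⊆ V)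
    (hs : ∀ x ∈ s, ∃ ε > 0, ∀ r, 0 < r → r < ε → μ (closedBall x r) ≠ ⊤ ∧
      ENNReal.ofReal (γ + 1) * μ (closedBall x (α * r)) < μ (closedBall x r)) :
    μ s = 0 := by
  rcases s.eq_empty_or_nonempty with rfl | ⟨z, -⟩
  · simp
  suffices h : ∀ n : ℕ, μ (s ∩ ball z n) = 0 by
    rw [← inter_univ s, ← iUnion_ball_nat z, inter_iUnion]
    exact measure_iUnion_null h
  intro n
  have hM : ν (ball z (n + 1)) ≠ ⊤ := (hν.1 _ isBounded_ball).ne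
  have hbd : ∀ κ : ℝ, 0 < κ → μ (s ∩ ball z n) ≤ ENNReal.ofReal κ * ν (ball z (n + 1)) := by
    intro κ hκ
    obtain ⟨P, hPc, hP, hPd, hP0⟩ := hdir.exists_disjoint_closedBall_covering_ae hξ hη'
      (μ.restrict V) (fun x => {r | μ (closedBall x r) ≤ ENNReal.ofReal κ * ν (closedBall x r)})
      (s ∩ ball z n) (fun x hx δ hδ => by
        obtain ⟨ε, hε, h⟩ := hs x hx.1
        obtain ⟨r, hr0, hrδ, hr⟩ := hν.exists_measure_le hα hα1 hγ hε
          (fun r h1 h2 => (h r h1 h2).1) (fun r h1 h2 => (h r h1 h2).2) hκ hδ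
        exact ⟨r, hr, hr0, hrδ⟩) (fun _ => 1) (fun _ _ => one_pos)
    calc μ (s ∩ ball z n) = μ.restrict V (s ∩ ball z n) :=
          (Measure.restrict_eq_self _ (inter_subset_left.trans hsV)).symm
      _ ≤ ∑' p : P, μ.restrict V (closedBall p.1.1 p.1.2) := measure_le_tsum_closedBall _ hPc hP0
      _ ≤ ∑' p : P, ENNReal.ofReal κ * ν (closedBall p.1.1 p.1.2) :=
          ENNReal.tsum_le_tsum fun p => (Measure.restrict_apply_le _ _).trans (hP p p.2).2.1
      _ = ENNReal.ofReal κ * ∑' p : P, ν (closedBall p.1.1 p.1.2) := ENNReal.tsum_mul_left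
      _ ≤ ENNReal.ofReal κ * ν (ball z (n + 1)) := by
          gcongr
          refine tsum_measure_closedBall_le ν hPc hPd fun p hp => ?_
          obtain ⟨⟨-, h1⟩, -, -, h2⟩ := hP p hp
          exact (closedBall_subset_closedBall h2.le).trans
            (closedBall_subset_ball' (by linarith [mem_ball.1 h1]))
  have hlim : Tendsto (fun κ : ℝ => ENNReal.ofReal κ * ν (ball z (n + 1))) (𝓝[>] 0) (𝓝 0) := by
    have h1 : Tendsto (fun κ : ℝ => ENNReal.ofReal κ) (𝓝[>] 0) (𝓝 0) := by
      simpa using (ENNReal.continuous_ofReal.tendsto 0).mono_left nhdsWithin_le_nhds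
    simpa using ENNReal.Tendsto.mul_const h1 (Or.inr hM)
  exact le_antisymm (ge_of_tendsto hlim (eventually_nhdsWithin_of_forall hbd)) zero_le

/-- The packing construction controls the measure from above on open sets. -/
lemma measure_le_packPre {X : Type*} [MetricSpace X] [MeasurableSpace X] [BorelSpace X]
    [TopologicalSpace.SeparableSpace X] {ξ η : ℝ} {ζ : ℕ} (hξ : 0 < ξ) (hη' : η ≤ 1 / 3)
    (hdir : DirLimited (Set.univ : Set X) ξ η ζ) {ν μ : Measure X} {α γ : ℝ} (hα : 0 < α)
    (hα1 : α ≤ 1) (hγ : 1 ≤ γ) (hν : AsympBounded ν α γ) {q : X → ℝ → ℝ≥0∞} {C r₀ : ℝ}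
    (hC : 1 ≤ C) (hr₀ : 0 < r₀)
    (hq₁ : ∀ (x : X) (r : ℝ), 0 < r → r < r₀ →
      ENNReal.ofReal (1 / C) * μ (closedBall x (α * r)) ≤ q x r)
    {V : Set X} (hV : IsOpen V) {δ : ℝ} (hδ : 0 < δ) :
    μ V ≤ ENNReal.ofReal (γ + 1) * (ENNReal.ofReal C * packPre q δ V) := by
  have hC0 : 0 < C := by linarith
  by_cases htop : packPre q δ V = ⊤
  · rw [htop, ENNReal.mul_top (by simpa using hC0), ENNReal.mul_top (by simp; linarith)]
    exact le_top
  have hqμ : ∀ (x : X) (r : ℝ), 0 < r → r < r₀ →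
      μ (closedBall x (α * r)) ≤ ENNReal.ofReal C * q x r := fun x r h1 h2 => by
    calc μ (closedBall x (α * r))
        = ENNReal.ofReal C * (ENNReal.ofReal (1 / C) * μ (closedBall x (α * r))) := by
          rw [← mul_assoc, ← ENNReal.ofReal_mul hC0.le, mul_one_div_cancel hC0.ne']
          simp
      _ ≤ _ := by gcongr; exact hq₁ x r h1 h2
  have hrad : ∀ x ∈ V, ∃ ρ > 0, ρ < r₀ ∧ ρ ≤ δ ∧ closedBall x ρ ⊆ V := fun x hx => by
    obtain ⟨ρ, hρ, hρV⟩ := nhds_basis_closedBall.mem_iff.1 (hV.mem_nhds hx)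
    refine ⟨min ρ (min (r₀ / 2) δ), by positivity, ?_, ?_, ?_⟩
    · exact ((min_le_right _ _).trans (min_le_left _ _)).trans_lt (by linarith)
    · exact (min_le_right _ _).trans (min_le_right _ _)
    · exact (closedBall_subset_closedBall (min_le_left _ _)).trans hρV
  choose! ρ hρ0 hρr hρδ hρV using hrad
  have hfin : ∀ x ∈ V, μ (closedBall x (α * ρ x)) ≠ ⊤ := fun x hx => by
    refine ne_top_of_le_ne_top (ENNReal.mul_ne_top ENNReal.ofReal_ne_top ?_)
      (hqμ x _ (hρ0 x hx) (hρr x hx))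
    exact ne_top_of_le_ne_top htop (le_packPre q (hρ0 x hx) (hρδ x hx) (hρV x hx))
  have : SFinite (μ.restrict V) := sFinite_restrict_of_finite_closedBall hV.measurableSet
    fun x hx => ⟨_, mul_pos hα (hρ0 x hx), hfin x hx⟩
  let f : X → Set ℝ := fun x =>
    {r | μ (closedBall x r) ≤ ENNReal.ofReal (γ + 1) * μ (closedBall x (α * r))}
  let G : Set X := {x | x ∈ V ∧ ∀ ε > 0, (f x ∩ Ioo 0 ε).Nonempty}
  have hGV : G ⊆ V := fun x hx => hx.1
  have hbad : μ (V \ G) = 0 := by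
    refine measure_setOf_fast_decay hξ hη' hdir hα hα1 hγ hν (V := V) sdiff_subset ?_
    rintro x ⟨hxV, hxG⟩
    have : ∃ ε > 0, ¬ (f x ∩ Ioo 0 ε).Nonempty := by
      by_contra! h
      exact hxG ⟨hxV, h⟩
    obtain ⟨ε, hε, hne⟩ := this
    refine ⟨min ε (α * ρ x), lt_min hε (mul_pos hα (hρ0 x hxV)), fun r hr0 hr => ⟨?_, ?_⟩⟩
    · exact ne_top_of_le_ne_top (hfin x hxV)
        (measure_mono (closedBall_subset_closedBall (hr.le.trans (min_le_right _ _))))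
    · by_contra! hle
      exact hne ⟨r, hle, hr0, hr.trans_le (min_le_left _ _)⟩
  obtain ⟨P, hPc, hP, hPd, hP0⟩ := hdir.exists_disjoint_closedBall_covering_ae hξ hη'
    (μ.restrict V) f G (fun x hx => hx.2) ρ (fun x hx => hρ0 x hx.1)
  have hPack : IsPackingOf V δ P := ⟨hPc, fun p hp => by
    obtain ⟨h1, -, h2, h3⟩ := hP p hp
    exact ⟨h2, h3.le.trans (hρδ _ h1.1),
      (closedBall_subset_closedBall h3.le).trans (hρV _ h1.1)⟩, hPd⟩
  calc μ V ≤ μ (V \ G ∪ G) := measure_mono (by rw [sdiff_union_of_subset hGV])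
    _ ≤ μ (V \ G) + μ G := measure_union_le _ _
    _ = μ.restrict V G := by rw [hbad, zero_add, Measure.restrict_eq_self _ hGV]
    _ ≤ ∑' p : P, μ.restrict V (closedBall p.1.1 p.1.2) := measure_le_tsum_closedBall _ hPc hP0
    _ ≤ ∑' p : P, ENNReal.ofReal (γ + 1) * (ENNReal.ofReal C * q p.1.1 p.1.2) := by
        refine ENNReal.tsum_le_tsum fun p => ?_
        obtain ⟨h1, h2, h3, h4⟩ := hP p p.2
        refine (Measure.restrict_apply_le _ _).trans (le_trans h2 ?_)
        gcongr
        exact hqμ _ _ h3 (h4.trans (hρr _ h1.1))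
    _ = ENNReal.ofReal (γ + 1) * (ENNReal.ofReal C * ∑' p : P, q p.1.1 p.1.2) := by
        rw [ENNReal.tsum_mul_left, ENNReal.tsum_mul_left]
    _ ≤ _ := by
        gcongr
        exact hPack.tsum_le_packPre

lemma exists_packPre_le {X : Type*} [MetricSpace X] {q : X → ℝ → ℝ≥0∞} {U : Set X}
    (h : packOpen q U ≠ ⊤) {ε : ℝ≥0∞} (hε : ε ≠ 0) :
    ∃ δ > 0, packPre q δ U ≤ packOpen q U + ε := by
  have hlt : packOpen q U < packOpen q U + ε := ENNReal.lt_add_right h hε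
  obtain ⟨δ, hδ'⟩ := iInf_lt_iff.1 hlt
  obtain ⟨hδ, h⟩ := iInf_lt_iff.1 hδ'
  exact ⟨δ, hδ, h.le⟩

lemma exists_packOpen_le {X : Type*} [MetricSpace X] {q : X → ℝ → ℝ≥0∞} {A : Set X}
    (h : packM q A ≠ ⊤) {ε : ℝ≥0∞} (hε : ε ≠ 0) :
    ∃ U, IsOpen U ∧ A ⊆ U ∧ packOpen q U ≤ packM q A + ε := by
  have hlt : packM q A < packM q A + ε := ENNReal.lt_add_right h hε
  obtain ⟨U, hU⟩ := iInf_lt_iff.1 hlt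
  simp only [iInf_lt_iff] at hU
  obtain ⟨hUo, hAU, h⟩ := hU
  exact ⟨U, hUo, hAU, h.le⟩

/-- Countable sub-additivity of the packing construction on arbitrary sets follows from the one
on open sets. -/
lemma packM_iUnion_le_of_isOpen {X : Type*} [MetricSpace X] {q : X → ℝ → ℝ≥0∞}
    (h : ∀ U : ℕ → Set X, (∀ n, IsOpen (U n)) →
      packOpen q (⋃ n, U n) ≤ ∑' n, packOpen q (U n)) (A : ℕ → Set X) :
    packM q (⋃ n, A n) ≤ ∑' n, packM q (A n) := by
  refine ENNReal.le_of_forall_pos_le_add fun ε hε htop => ?_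
  obtain ⟨e, he0, he⟩ := ENNReal.exists_pos_sum_of_countable' (ENNReal.coe_ne_zero.2 hε.ne') ℕ
  choose U hUo hAU hU using fun n =>
    exists_packOpen_le (ENNReal.ne_top_of_tsum_ne_top htop.ne n) (he0 n).ne'
  calc packM q (⋃ n, A n) ≤ packOpen q (⋃ n, U n) :=
        iInf_le_of_le (⋃ n, U n) (iInf₂_le (isOpen_iUnion hUo) (iUnion_mono hAU))
    _ ≤ ∑' n, packOpen q (U n) := h U hUo
    _ ≤ ∑' n, (packM q (A n) + e n) := ENNReal.tsum_le_tsum hU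
    _ = ∑' n, packM q (A n) + ∑' n, e n := ENNReal.tsum_add
    _ ≤ _ := by gcongr

/-- Given a countable open cover with scales `δ n`, all balls of small radius contained in the
union are contained in a single member, up to balls sitting in a set of small measure. -/
lemma exists_lebesgue_number_ae {X : Type*} [MetricSpace X] [MeasurableSpace X] [BorelSpace X]
    {μ : Measure X} {U : ℕ → Set X} (hU : ∀ n, IsOpen (U n)) (hμ : μ (⋃ n, U n) ≠ ⊤)
    {δ : ℕ → ℝ} (hδ : ∀ n, 0 < δ n) {r₀ : ℝ} (hr₀ : 0 < r₀) {ε : ℝ≥0∞} (hε : 0 < ε) :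
    ∃ E : Set X, μ E < ε ∧ ∃ ρ > 0, ρ < r₀ ∧ ∀ x r, 0 < r → r ≤ ρ →
      closedBall x r ⊆ ⋃ n, U n → closedBall x r ⊆ E ∨ ∃ n, r ≤ δ n ∧ closedBall x r ⊆ U n := by
  let d : ℕ → ℝ := fun k => 1 / ((k : ℝ) + 1)
  have hd0 : ∀ k, 0 < d k := fun k => Nat.one_div_pos_of_nat
  have hd : Antitone d := fun i j hij => Nat.one_div_le_one_div hij
  have hdlim : Tendsto d atTop (𝓝 0) := tendsto_one_div_add_atTop_nhds_zero_nat
  let E : ℕ → Set X := fun k =>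
    (⋃ n, U n) \ ⋃ n ∈ {n | d k ≤ δ n}, (thickening (3 * d k) (U n)ᶜ)ᶜ
  have hEm : ∀ k, MeasurableSet (E k) := fun k =>
    (isOpen_iUnion hU).measurableSet.diff (MeasurableSet.biUnion (to_countable _)
      fun n _ => isOpen_thickening.measurableSet.compl)
  have hEa : Antitone E := fun i j hij => by
    refine sdiff_subset_sdiff_right ?_
    refine biUnion_mono (fun n hn => (hd hij).trans hn) fun n _ => compl_subset_compl.2 ?_
    exact thickening_mono (by linarith [hd hij]) _
  have hEi : ⋂ k, E k = ∅ := by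
    refine eq_empty_of_forall_notMem fun x hx => ?_
    rw [mem_iInter] at hx
    obtain ⟨n, hn⟩ := mem_iUnion.1 (hx 0).1
    obtain ⟨ρ, hρ, hρU⟩ := Metric.isOpen_iff.1 (hU n) x hn
    obtain ⟨k, hk1, hk2⟩ := ((hdlim.eventually_le_const (hδ n)).and
      (hdlim.eventually_le_const (show 0 < ρ / 3 by linarith))).exists
    refine (hx k).2 (mem_biUnion (show n ∈ {n | d k ≤ δ n} from hk1) fun hth => ?_)
    obtain ⟨y, hy, hxy⟩ := mem_thickening_iff.1 hth
    exact hy (hρU (mem_ball'.2 (hxy.trans_le (by linarith))))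
  have hlim := tendsto_measure_iInter_atTop (μ := μ) (fun k => (hEm k).nullMeasurableSet) hEa
    ⟨0, ne_top_of_le_ne_top hμ (measure_mono sdiff_subset)⟩
  rw [hEi, measure_empty] at hlim
  obtain ⟨k, hk1, hk2⟩ := ((hlim.eventually_lt_const hε).and
    (hdlim.eventually_lt_const hr₀)).exists
  refine ⟨E k, hk1, d k, hd0 k, hk2, fun x r hr hrk hxr => ?_⟩
  by_cases h : closedBall x r ⊆ E k
  · exact Or.inl h
  right
  obtain ⟨y, hy, hyE⟩ := not_subset.1 h
  have hyG : y ∈ ⋃ n ∈ {n | d k ≤ δ n}, (thickening (3 * d k) (U n)ᶜ)ᶜ := by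
    by_contra hyG
    exact hyE ⟨hxr hy, hyG⟩
  obtain ⟨n, hn, hyn⟩ := mem_iUnion₂.1 hyG
  refine ⟨n, hrk.trans hn, fun w hw => ?_⟩
  by_contra hwU
  refine hyn (mem_thickening_iff.2 ⟨w, hwU, ?_⟩)
  have h1 := dist_triangle_right y w x
  linarith [mem_closedBall.1 hy, mem_closedBall.1 hw, hd0 k]

lemma IsPackingOf.subset {X : Type*} [MetricSpace X] {U V : Set X} {δ δ' : ℝ}
    {P P' : Set (X × ℝ)} (hP : IsPackingOf U δ P) (h : P' ⊆ P)
    (h' : ∀ p ∈ P', p.2 ≤ δ' ∧ closedBall p.1 p.2 ⊆ V) : IsPackingOf V δ' P' :=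
  ⟨hP.1.mono h, fun p hp => ⟨(hP.2.1 p (h hp)).1, h' p hp⟩, hP.2.2.mono h⟩

/-- Countable sub-additivity of the packing construction on open sets, when the measure of each of
them is controlled by the packing construction. -/
lemma packOpen_iUnion_le {X : Type*} [MetricSpace X] [MeasurableSpace X] [BorelSpace X]
    {μ : Measure X} {q : X → ℝ → ℝ≥0∞} {C r₀ : ℝ} (hr₀ : 0 < r₀)
    (hq₂ : ∀ (x : X) (r : ℝ), 0 < r → r < r₀ → q x r ≤ ENNReal.ofReal C * μ (closedBall x r))
    {K : ℝ≥0∞} (hK : K ≠ ⊤)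
    (hμ : ∀ V : Set X, IsOpen V → ∀ δ : ℝ, 0 < δ → μ V ≤ K * packPre q δ V)
    (U : ℕ → Set X) (hU : ∀ n, IsOpen (U n)) :
    packOpen q (⋃ n, U n) ≤ ∑' n, packOpen q (U n) := by
  refine ENNReal.le_of_forall_pos_le_add fun ε hε htop => ?_
  have hε2 : (ε : ℝ≥0∞) / 2 ≠ 0 := by simpa using hε.ne'
  obtain ⟨e, he0, he⟩ := ENNReal.exists_pos_sum_of_countable' hε2 ℕ
  choose δ hδ0 hδ using fun n =>
    exists_packPre_le (ENNReal.ne_top_of_tsum_ne_top htop.ne n) (he0 n).ne'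
  have hsum : ∑' n, packPre q (δ n) (U n) ≤ ∑' n, packOpen q (U n) + ε / 2 :=
    calc ∑' n, packPre q (δ n) (U n) ≤ ∑' n, (packOpen q (U n) + e n) := ENNReal.tsum_le_tsum hδ
      _ = ∑' n, packOpen q (U n) + ∑' n, e n := ENNReal.tsum_add
      _ ≤ _ := by gcongr
  have hfin : μ (⋃ n, U n) ≠ ⊤ := by
    refine ne_top_of_le_ne_top (ENNReal.mul_ne_top hK (ne_top_of_le_ne_top ?_ hsum))
      ((measure_iUnion_le U).trans ((ENNReal.tsum_le_tsum fun n => hμ _ (hU n) _ (hδ0 n)).trans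
        ENNReal.tsum_mul_left.le))
    exact ENNReal.add_ne_top.2 ⟨htop.ne, ENNReal.div_ne_top ENNReal.coe_ne_top two_ne_zero⟩
  obtain ⟨E, hE, ρ, hρ0, hρr, hρ⟩ := exists_lebesgue_number_ae hU hfin hδ0 hr₀
    (ENNReal.div_pos hε2 (ENNReal.ofReal_ne_top (r := C)))
  have hCE : ENNReal.ofReal C * μ E ≤ ε / 2 := by
    rw [mul_comm]
    exact ENNReal.mul_le_of_le_div hE.le
  refine (iInf₂_le ρ hρ0).trans (iSup₂_le fun P hP => ?_)
  let PE : Set (X × ℝ) := {p ∈ P | closedBall p.1 p.2 ⊆ E}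
  let PU : ℕ → Set (X × ℝ) := fun n => {p ∈ P | p.2 ≤ δ n ∧ closedBall p.1 p.2 ⊆ U n}
  have hcov : P ⊆ (⋃ n, PU n) ∪ PE := fun p hp => by
    obtain ⟨h1, h2, h3⟩ := hP.2.1 p hp
    rcases hρ _ _ h1 h2 h3 with h | ⟨n, h⟩
    · exact Or.inr ⟨hp, h⟩
    · exact Or.inl (mem_iUnion.2 ⟨n, hp, h⟩)
  have hPE : PE ⊆ P := fun p hp => hp.1
  calc ∑' p : P, q p.1.1 p.1.2
      ≤ ∑' p : ((⋃ n, PU n) ∪ PE : Set (X × ℝ)), q p.1.1 p.1.2 :=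
        ENNReal.tsum_mono_subtype (fun p : X × ℝ => q p.1 p.2) hcov
    _ ≤ ∑' p : (⋃ n, PU n), q p.1.1 p.1.2 + ∑' p : PE, q p.1.1 p.1.2 :=
        ENNReal.tsum_union_le (fun p : X × ℝ => q p.1 p.2) _ _
    _ ≤ ∑' n, packPre q (δ n) (U n) + ENNReal.ofReal C * μ E := by
        gcongr
        · refine (ENNReal.tsum_iUnion_le_tsum (fun p : X × ℝ => q p.1 p.2) _).trans
            (ENNReal.tsum_le_tsum fun n => ?_)
          exact (hP.subset (fun p hp => hp.1) fun p hp => hp.2).tsum_le_packPre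
        · calc ∑' p : PE, q p.1.1 p.1.2
              ≤ ∑' p : PE, ENNReal.ofReal C * μ (closedBall p.1.1 p.1.2) :=
                ENNReal.tsum_le_tsum fun p => by
                  obtain ⟨h1, h2, -⟩ := hP.2.1 p p.2.1
                  exact hq₂ _ _ h1 (h2.trans_lt hρr)
            _ = ENNReal.ofReal C * ∑' p : PE, μ (closedBall p.1.1 p.1.2) := ENNReal.tsum_mul_left
            _ ≤ _ := by
                gcongr
                exact tsum_measure_closedBall_le μ (hP.1.mono hPE) (hP.2.2.mono hPE)
                  fun p hp => hp.2
    _ ≤ (∑' n, packOpen q (U n) + ε / 2) + ε / 2 := by gcongr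
    _ = ∑' n, packOpen q (U n) + ε := by rw [add_assoc, ENNReal.add_halves]

/-- under Hypothesis 1 and the two-sided bound
`C⁻¹ μ(B_{αr}(x)) ≤ q(B_r(x)) ≤ C μ(B_r(x))` for `0 < r < r₀` (with `μ` not necessarily
finite on bounded sets), the packing construction `ĥμ^q` is countably sub-additive. -/
theorem stmt15 {X : Type*} [MetricSpace X] [MeasurableSpace X] [BorelSpace X]
    [TopologicalSpace.SeparableSpace X]
    (ξ η : ℝ) (ζ : ℕ) (hξ : 0 < ξ) (hη : 0 < η) (hη' : η ≤ 1/3) (hζ : 0 < ζ)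
    (hdir : DirLimited (Set.univ : Set X) ξ η ζ)
    (ν : Measure X) (α γ : ℝ) (hα : 0 < α) (hα1 : α ≤ 1) (hγ : 1 ≤ γ)
    (hν : AsympBounded ν α γ)
    (μ : Measure X) (q : X → ℝ → ℝ≥0∞) (C r₀ : ℝ) (hC : 1 ≤ C) (hr₀ : 0 < r₀)
    (hq₁ : ∀ (x : X) (r : ℝ), 0 < r → r < r₀ →
      ENNReal.ofReal (1 / C) * μ (Metric.closedBall x (α * r)) ≤ q x r)
    (hq₂ : ∀ (x : X) (r : ℝ), 0 < r → r < r₀ →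
      q x r ≤ ENNReal.ofReal C * μ (Metric.closedBall x r)) :
    ∀ A : ℕ → Set X, packM q (⋃ n, A n) ≤ ∑' n, packM q (A n) := by
  refine packM_iUnion_le_of_isOpen (packOpen_iUnion_le hr₀ hq₂
    (ENNReal.mul_ne_top (ENNReal.ofReal_ne_top (r := γ + 1)) (ENNReal.ofReal_ne_top (r := C)))
    fun V hV δ hδ => ?_)
  rw [mul_assoc]
  exact measure_le_packPre hξ hη' hdir hα hα1 hγ hν hC hr₀ hq₁ hV hδ
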